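/- (Theorem A, family version.) For k ∈ ℕ let p_k = F_{P_k} where P_k(s) = s − G k, i.e. p_k(x₁,x₂) = (−x₂ + x₁(x₁²+x₂²−G k), x₁ + x₂(x₁²+x₂²−G k)). Define N : ℕ → ℕ by N k = the number (Set.ncard) of distinct sets S ⊆ ℝ × ℝ that are ranges of nonconstant periodic solutions of x' = p_k(x). Then N k = 1 if machine k halts on input k and N k = 0 otherwise, and the function N is not computable. -/

import Mathlib

/-- `g k i = 1` if machine `k` halts on input `k` within `i` steps, else `0`. -/
noncomputable def haltStep (k i : ℕ) : ℝ :=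
  if (Nat.Partrec.Code.evaln i (Denumerable.ofNat Nat.Partrec.Code k) k).isSome then 1 else 0

/-- `G k = ∑_{i=1}^∞ g k i / 2^(i+1)`. -/
noncomputable def haltSum (k : ℕ) : ℝ :=
  ∑' i : ℕ, haltStep k (i + 1) / 2 ^ (i + 2)

/-- The planar vector field `F_P(x₁,x₂) = (−x₂ + x₁·P(x₁²+x₂²), x₁ + x₂·P(x₁²+x₂²))`. -/
def planarField (P : ℝ → ℝ) (x : ℝ × ℝ) : ℝ × ℝ :=
  (-x.2 + x.1 * P (x.1 ^ 2 + x.2 ^ 2), x.1 + x.2 * P (x.1 ^ 2 + x.2 ^ 2))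

/-- `S` is a periodic orbit of `x' = F_P(x)`: the range of a nonconstant periodic solution. -/
def IsPeriodicOrbit (P : ℝ → ℝ) (S : Set (ℝ × ℝ)) : Prop :=
  ∃ x : ℝ → ℝ × ℝ, (∀ t : ℝ, HasDerivAt x (planarField P (x t)) t) ∧
    (∃ T : ℝ, 0 < T ∧ ∀ t : ℝ, x (t + T) = x t) ∧
    (¬ ∃ p : ℝ × ℝ, ∀ t : ℝ, x t = p) ∧
    S = Set.range x

/-- The number of periodic orbits of the system `x' = p_k(x)`,
where `p_k = F_P` with `P s = s - G k`. -/
noncomputable def numOrbits (k : ℕ) : ℕ :=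
  {S : Set (ℝ × ℝ) | IsPeriodicOrbit (fun s => s - haltSum k) S}.ncard

theorem haltStep_nonneg (k i : ℕ) : 0 ≤ haltStep k i := by
  unfold haltStep; split_ifs <;> norm_num

theorem haltStep_le_one (k i : ℕ) : haltStep k i ≤ 1 := by
  unfold haltStep; split_ifs <;> norm_num

theorem summable_haltStep (k : ℕ) :
    Summable fun i : ℕ => haltStep k (i + 1) / 2 ^ (i + 2) := by
  refine Summable.of_nonneg_of_le
    (fun i => div_nonneg (haltStep_nonneg _ _) (by positivity)) (fun i => ?_)
    summable_geometric_two
  rw [div_pow, one_pow]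
  exact div_le_div₀ zero_le_one (haltStep_le_one _ _) (by positivity)
    (pow_le_pow_right₀ one_le_two (by omega))

theorem haltSum_pos {k : ℕ}
    (h : ((Denumerable.ofNat Nat.Partrec.Code k).eval k).Dom) : 0 < haltSum k := by
  obtain ⟨i, hi⟩ := Nat.Partrec.Code.evaln_complete.1 (Part.get_mem h)
  have hi' := Nat.Partrec.Code.evaln_mono (Nat.le_succ i) hi
  refine (summable_haltStep k).tsum_pos
    (fun i => div_nonneg (haltStep_nonneg _ _) (by positivity)) i ?_
  have : haltStep k (i + 1) = 1 := by
    unfold haltStep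
    rw [if_pos]
    exact Option.isSome_iff_exists.2 ⟨_, hi'⟩
  rw [this]
  positivity

theorem haltSum_eq_zero {k : ℕ}
    (h : ¬ ((Denumerable.ofNat Nat.Partrec.Code k).eval k).Dom) : haltSum k = 0 := by
  have h0 : ∀ i, haltStep k i = 0 := by
    intro i
    unfold haltStep
    rw [if_neg]
    intro hs
    obtain ⟨y, hy⟩ := Option.isSome_iff_exists.1 hs
    exact h (Part.dom_iff_mem.2 ⟨y, Nat.Partrec.Code.evaln_sound hy⟩)
  simp [haltSum, h0]

/-- A periodic solution of the scalar equation `r' = 2 r (r - a)` with `r, a ≥ 0` is one of the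
two equilibria. -/
theorem eq_zero_or_eq_of_periodic {a : ℝ} {r : ℝ → ℝ} (ha : 0 ≤ a) (hr : ∀ t, 0 ≤ r t)
    (hd : ∀ t, HasDerivAt r (2 * r t * (r t - a)) t) {T : ℝ} (hT : 0 < T)
    (hper : Function.Periodic r T) : (∀ t, r t = 0) ∨ ∀ t, r t = a := by
  have hc : Continuous r := continuous_iff_continuousAt.2 fun t => (hd t).continuousAt
  have hle : ∀ t, r t ≤ a := by
    obtain ⟨m, -, hm⟩ := isCompact_Icc.exists_isMaxOn (Set.nonempty_Icc.2 hT.le) hc.continuousOn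
    have hmax : ∀ t, r t ≤ r m := by
      intro t
      obtain ⟨s, hs, hst⟩ := hper.exists_mem_Ico₀ hT t
      rw [hst]
      exact hm (Set.Ico_subset_Icc_self hs)
    have h0 : 2 * r m * (r m - a) = 0 :=
      IsLocalMax.hasDerivAt_eq_zero (Filter.Eventually.of_forall hmax) (hd m)
    have hma : r m ≤ a := by
      rcases mul_eq_zero.1 h0 with h | h <;> linarith
    exact fun t => (hmax t).trans hma
  have hanti : Antitone r := by
    refine antitone_of_hasDerivAt_nonpos hd fun t => ?_
    have := mul_nonneg (hr t) (sub_nonneg.2 (hle t))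
    simp only [Pi.zero_apply]
    nlinarith
  have hconst : ∀ t, r t = r 0 := by
    intro t
    obtain ⟨s, hs, hst⟩ := hper.exists_mem_Ico₀ hT t
    rw [hst]
    refine le_antisymm (hanti hs.1) ?_
    have h1 : r T = r 0 := by simpa using hper 0
    rw [← h1]
    exact hanti hs.2.le
  have h0 : 2 * r 0 * (r 0 - a) = 0 :=
    (hd 0).unique (by rw [funext hconst]; exact hasDerivAt_const _ _)
  rcases mul_eq_zero.1 h0 with h | h
  · exact Or.inl fun t => by rw [hconst]; linarith
  · exact Or.inr fun t => by rw [hconst]; linarith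

/-- A solution of the rotation equation on the circle of squared radius `a > 0` covers it. -/
theorem range_eq_of_rotation {a : ℝ} {x : ℝ → ℝ × ℝ} (ha : 0 < a)
    (hd : ∀ t, HasDerivAt x (-(x t).2, (x t).1) t)
    (hr : ∀ t, (x t).1 ^ 2 + (x t).2 ^ 2 = a) :
    Set.range x = {p : ℝ × ℝ | p.1 ^ 2 + p.2 ^ 2 = a} := by
  have h1 : ∀ t, HasDerivAt (fun t => (x t).1) (-(x t).2) t := fun t => (hd t).fst
  have h2 : ∀ t, HasDerivAt (fun t => (x t).2) (x t).1 t := fun t => (hd t).snd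
  have hu : ∀ t, (x t).1 * Real.cos t + (x t).2 * Real.sin t = (x 0).1 := by
    intro t
    have h := is_const_of_deriv_eq_zero
      (f := fun t => (x t).1 * Real.cos t + (x t).2 * Real.sin t)
      (fun t => (((h1 t).mul (Real.hasDerivAt_cos t)).add
        ((h2 t).mul (Real.hasDerivAt_sin t))).differentiableAt)
      (fun t => ((((h1 t).mul (Real.hasDerivAt_cos t)).add
        ((h2 t).mul (Real.hasDerivAt_sin t))).deriv).trans (by ring)) t 0
    simpa using h
  have hv : ∀ t, (x t).2 * Real.cos t - (x t).1 * Real.sin t = (x 0).2 := by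
    intro t
    have h := is_const_of_deriv_eq_zero
      (f := fun t => (x t).2 * Real.cos t - (x t).1 * Real.sin t)
      (fun t => (((h2 t).mul (Real.hasDerivAt_cos t)).sub
        ((h1 t).mul (Real.hasDerivAt_sin t))).differentiableAt)
      (fun t => ((((h2 t).mul (Real.hasDerivAt_cos t)).sub
        ((h1 t).mul (Real.hasDerivAt_sin t))).deriv).trans (by ring)) t 0
    simpa using h
  ext ⟨p, q⟩
  constructor
  · rintro ⟨t, ht⟩
    have := hr t
    rwa [ht] at this
  · intro hpq
    simp only [Set.mem_ofPred_eq] at hpq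
    have h0 := hr 0
    set c := (x 0).1
    set d := (x 0).2
    let z : ℂ := ⟨(p * c + q * d) / a, (q * c - p * d) / a⟩
    have hz : ‖z‖ = 1 := by
      rw [← sq_eq_sq₀ (norm_nonneg z) zero_le_one, ← Complex.normSq_eq_norm_sq,
        Complex.normSq_apply]
      simp only [z]
      field_simp
      calc _ = (p ^ 2 + q ^ 2) * (c ^ 2 + d ^ 2) := by ring
        _ = _ := by rw [hpq, h0]; ring
    have hcos : Real.cos z.arg = (p * c + q * d) / a := by
      rw [Complex.cos_arg (norm_ne_zero_iff.1 (by simp [hz])), hz, div_one]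
    have hsin : Real.sin z.arg = (q * c - p * d) / a := by
      rw [Complex.sin_arg, hz, div_one]
    refine ⟨z.arg, ?_⟩
    have e1 := hu z.arg
    have e2 := hv z.arg
    have e3 := Real.sin_sq_add_cos_sq z.arg
    have k1 : (x z.arg).1 = c * Real.cos z.arg - d * Real.sin z.arg := by
      linear_combination Real.cos z.arg * e1 - Real.sin z.arg * e2 - (x z.arg).1 * e3
    have k2 : (x z.arg).2 = c * Real.sin z.arg + d * Real.cos z.arg := by
      linear_combination Real.sin z.arg * e1 + Real.cos z.arg * e2 - (x z.arg).2 * e3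
    refine Prod.ext ?_ ?_
    · rw [k1, hcos, hsin]
      field_simp
      linear_combination p * h0
    · rw [k2, hcos, hsin]
      field_simp
      linear_combination q * h0

theorem isPeriodicOrbit_sub_const_iff {a : ℝ} (ha : 0 ≤ a) (S : Set (ℝ × ℝ)) :
    IsPeriodicOrbit (fun s => s - a) S ↔
      0 < a ∧ S = {p : ℝ × ℝ | p.1 ^ 2 + p.2 ^ 2 = a} := by
  constructor
  · rintro ⟨x, hx, ⟨T, hT, hper⟩, hnc, rfl⟩
    have h1 : ∀ t, HasDerivAt (fun t => (x t).1) (planarField (fun s => s - a) (x t)).1 t :=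
      fun t => (hx t).fst
    have h2 : ∀ t, HasDerivAt (fun t => (x t).2) (planarField (fun s => s - a) (x t)).2 t :=
      fun t => (hx t).snd
    have hr : ∀ t, HasDerivAt (fun t => (x t).1 ^ 2 + (x t).2 ^ 2)
        (2 * ((x t).1 ^ 2 + (x t).2 ^ 2) * ((x t).1 ^ 2 + (x t).2 ^ 2 - a)) t := fun t =>
      (((h1 t).pow 2).add ((h2 t).pow 2)).congr_deriv (by simp [planarField]; ring)
    rcases eq_zero_or_eq_of_periodic ha (fun t => by positivity) hr hT
      (fun t => by simp only [hper t]) with h | h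
    · refine absurd ⟨0, fun t => ?_⟩ hnc
      have := h t
      exact Prod.ext (by simp; nlinarith [sq_nonneg (x t).1, sq_nonneg (x t).2])
        (by simp; nlinarith [sq_nonneg (x t).1, sq_nonneg (x t).2])
    · have hpos : 0 < a := by
        refine ha.lt_of_ne' fun h0 => hnc ⟨0, fun t => ?_⟩
        have := h t
        exact Prod.ext (by simp; nlinarith [sq_nonneg (x t).1, sq_nonneg (x t).2])
          (by simp; nlinarith [sq_nonneg (x t).1, sq_nonneg (x t).2])
      refine ⟨hpos, range_eq_of_rotation hpos (fun t => ?_) h⟩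
      have := hx t
      simpa [planarField, h t] using this
  · rintro ⟨hpos, rfl⟩
    let x : ℝ → ℝ × ℝ := fun t => (√a * Real.cos t, √a * Real.sin t)
    have hd : ∀ t, HasDerivAt x (-(x t).2, (x t).1) t := fun t =>
      (((Real.hasDerivAt_cos t).const_mul √a).prodMk
        ((Real.hasDerivAt_sin t).const_mul √a)).congr_deriv (by simp [x])
    have hr : ∀ t, (x t).1 ^ 2 + (x t).2 ^ 2 = a := fun t => by
      simp only [x]
      linear_combination √a ^ 2 * Real.sin_sq_add_cos_sq t + Real.sq_sqrt ha
    refine ⟨x, fun t => ?_, ⟨2 * Real.pi, Real.two_pi_pos, fun t => by simp [x]⟩, ?_,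
      (range_eq_of_rotation hpos hd hr).symm⟩
    · simpa [planarField, hr t] using hd t
    · rintro ⟨p, hp⟩
      have h : (x 0).1 = (x Real.pi).1 := by rw [hp, hp]
      have := Real.sqrt_pos.2 hpos
      simp only [x, Real.cos_zero, Real.cos_pi] at h
      linarith

theorem numOrbits_eq_one {k : ℕ}
    (h : ((Denumerable.ofNat Nat.Partrec.Code k).eval k).Dom) : numOrbits k = 1 := by
  have hpos := haltSum_pos h
  simp [numOrbits, isPeriodicOrbit_sub_const_iff hpos.le, hpos]

theorem numOrbits_eq_zero {k : ℕ}
    (h : ¬ ((Denumerable.ofNat Nat.Partrec.Code k).eval k).Dom) : numOrbits k = 0 := by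
  have h0 := haltSum_eq_zero h
  simp only [numOrbits, isPeriodicOrbit_sub_const_iff h0.ge]
  simp [h0]

/-- The diagonal halting problem is undecidable. -/
theorem not_computablePred_halt_self :
    ¬ ComputablePred fun k : ℕ => ((Denumerable.ofNat Nat.Partrec.Code k).eval k).Dom := by
  intro h
  obtain ⟨f, hf, hfe⟩ := ComputablePred.computable_iff.1 h
  refine ComputablePred.halting_problem 0 (ComputablePred.computable_iff.2
    ⟨fun c => f (Encodable.encode (c.comp (Nat.Partrec.Code.const 0))), hf.comp ?_, ?_⟩)
  · exact Computable.encode.comp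
      (Nat.Partrec.Code.primrec₂_comp.to_comp.comp Computable.id (Computable.const _))
  · funext c
    rw [← congrFun hfe]
    have heval : ∀ n, (c.comp (Nat.Partrec.Code.const 0)).eval n = c.eval 0 := fun n =>
      (congrArg (Part.bind · c.eval) (Nat.Partrec.Code.eval_const 0 n)).trans
        (Part.bind_some 0 c.eval)
    rw [Denumerable.ofNat_encode, heval]

theorem stmt6 :
    (∀ k : ℕ,
      (((Denumerable.ofNat Nat.Partrec.Code k).eval k).Dom → numOrbits k = 1) ∧
      (¬ ((Denumerable.ofNat Nat.Partrec.Code k).eval k).Dom → numOrbits k = 0)) ∧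
    ¬ Computable numOrbits := by
  refine ⟨fun k => ⟨numOrbits_eq_one, numOrbits_eq_zero⟩, fun hc => ?_⟩
  refine not_computablePred_halt_self (ComputablePred.computable_iff.2
    ⟨fun k => decide (numOrbits k = 1),
      (Primrec.eq (α := ℕ)).decide.to_comp.comp hc (Computable.const 1), ?_⟩)
  funext k
  by_cases h : ((Denumerable.ofNat Nat.Partrec.Code k).eval k).Dom
  · simp [h, numOrbits_eq_one h]
  · simp [h, numOrbits_eq_zero h]
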